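/- arXiv:1709.02266 — 2 statements merged into one kernel-verified Lean document; each statement's English description precedes it below -/
import Mathlib

section
/- Let μ be a Borel probability measure on ℝ with all moments finite that is determined by its moments (any Borel probability measure on ℝ with the same moments equals μ). Let α_1,α_2,… ∈ ℝ and β_1,β_2,… ≥ 0 be the recurrence coefficients of the monic orthogonal polynomials of μ, with the convention β_j := 0 and α_{j+1} := 0 for j ≥ N if μ is supported on exactly N points. Define polynomials by A_0 := 0, B_0 := 1, A_1 := 1, B_1(z) := z−α_1 and A_j(z) = (z−α_j)A_{j−1}(z) − β_{j−1}A_{j−2}(z), B_j(z) = (z−α_j)B_{j−1}(z) − β_{j−1}B_{j−2}(z) for j ≥ 2. Then, as l→∞, the convergents A_l(z)/B_l(z) converge to the Stieltjes transform Φ(z) = ∫ 1/(z−x) dμ(x), uniformly on every compact subset of the upper half plane ℂ⁺ = {z ∈ ℂ : Im z > 0}. -/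
open MeasureTheory Real Filter Topology Polynomial

noncomputable section

/-- Truncation of a function at height `R`. -/
def truncate (R y : ℝ) : ℝ := max (-R) (min R y)

lemma continuous_truncate (R : ℝ) : Continuous (truncate R) := by
  unfold truncate; fun_prop

lemma abs_truncate_le {R : ℝ} (hR : 0 ≤ R) (y : ℝ) : |truncate R y| ≤ R := by
  rw [abs_le]
  exact ⟨le_max_left _ _, max_le (by linarith) (min_le_left _ _)⟩

lemma abs_sub_truncate_le {R : ℝ} (hR : 0 < R) (y : ℝ) : |y - truncate R y| ≤ y ^ 2 / R := by
  rw [le_div_iff₀ hR]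
  unfold truncate
  rcases le_total R y with h | h
  · rw [min_eq_left h, max_eq_right (by linarith), abs_of_nonneg (by linarith)]
    nlinarith
  · rw [min_eq_right h]
    rcases le_total (-R) y with h' | h'
    · rw [max_eq_right h', sub_self, abs_zero, zero_mul]
      positivity
    · rw [max_eq_left h', abs_of_nonpos (by linarith)]
      nlinarith

lemma integrable_truncate {ν : Measure ℝ} [IsFiniteMeasure ν] {f : ℝ → ℝ} (hf : Continuous f)
    {R : ℝ} (hR : 0 ≤ R) : Integrable (fun x => truncate R (f x)) ν :=
  Integrable.of_bound ((continuous_truncate R).comp hf).aestronglyMeasurable R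
    (ae_of_all _ fun x => abs_truncate_le hR (f x))

lemma abs_integral_sub_integral_truncate_le {ν : Measure ℝ} [IsFiniteMeasure ν] {f : ℝ → ℝ}
    (hf : Continuous f) (h1 : Integrable f ν) (h2 : Integrable (fun x => f x ^ 2) ν) {R : ℝ}
    (hR : 0 < R) :
    |∫ x, f x ∂ν - ∫ x, truncate R (f x) ∂ν| ≤ (∫ x, f x ^ 2 ∂ν) / R := by
  rw [← integral_sub h1 (integrable_truncate hf hR.le), ← integral_div]
  refine (abs_integral_le_integral_abs).trans (integral_mono ?_ (h2.div_const R) fun x => ?_)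
  · exact (h1.sub (integrable_truncate hf hR.le)).abs
  · exact abs_sub_truncate_le hR (f x)

lemma tendsto_integral_truncate {ι : Type*} {F : Filter ι} {ν : ι → ProbabilityMeasure ℝ}
    {ρ : ProbabilityMeasure ℝ} (h : Tendsto ν F (𝓝 ρ)) {f : ℝ → ℝ} (hf : Continuous f) {R : ℝ}
    (hR : 0 ≤ R) :
    Tendsto (fun i => ∫ x, truncate R (f x) ∂(ν i : Measure ℝ)) F
      (𝓝 (∫ x, truncate R (f x) ∂(ρ : Measure ℝ))) :=
  ProbabilityMeasure.tendsto_iff_forall_integral_tendsto.1 h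
    (BoundedContinuousFunction.ofNormedAddCommGroup (fun x => truncate R (f x))
      ((continuous_truncate R).comp hf) R fun x => abs_truncate_le hR (f x))

/-- A weak limit of probability measures inherits integrability, and a bound on the integral, of a
nonnegative continuous function. -/
lemma integrable_and_integral_le_of_tendsto {ι : Type*} {F : Filter ι} [F.NeBot]
    {ν : ι → ProbabilityMeasure ℝ} {ρ : ProbabilityMeasure ℝ} (h : Tendsto ν F (𝓝 ρ))
    {f : ℝ → ℝ} (hf : Continuous f) (hf0 : ∀ x, 0 ≤ f x) {M : ℝ}
    (hint : ∀ i, Integrable f (ν i : Measure ℝ))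
    (hM : ∀ᶠ i in F, ∫ x, f x ∂(ν i : Measure ℝ) ≤ M) :
    Integrable f (ρ : Measure ℝ) ∧ ∫ x, f x ∂(ρ : Measure ℝ) ≤ M := by
  have htr : ∀ (n : ℕ) x, truncate n (f x) = min (n : ℝ) (f x) := fun n x =>
    max_eq_right (le_min (neg_le_self n.cast_nonneg) ((neg_nonpos.2 n.cast_nonneg).trans (hf0 x)))
  have hle : ∀ n : ℕ, ∫ x, truncate n (f x) ∂(ρ : Measure ℝ) ≤ M := by
    intro n
    refine le_of_tendsto (tendsto_integral_truncate h hf n.cast_nonneg) ?_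
    filter_upwards [hM] with i hi
    refine (integral_mono (integrable_truncate hf n.cast_nonneg) (hint i) fun x => ?_).trans hi
    simp only [htr]
    exact min_le_right _ _
  have hM0 : 0 ≤ M := by
    obtain ⟨i, hi⟩ := hM.exists
    exact (integral_nonneg hf0).trans hi
  have hlint : ∫⁻ x, ENNReal.ofReal (f x) ∂(ρ : Measure ℝ) ≤ ENNReal.ofReal M := by
    have hlim : Tendsto (fun n : ℕ => ∫⁻ x, ENNReal.ofReal (truncate n (f x)) ∂(ρ : Measure ℝ))
        atTop (𝓝 (∫⁻ x, ENNReal.ofReal (f x) ∂(ρ : Measure ℝ))) := by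
      refine lintegral_tendsto_of_tendsto_of_monotone (fun n => ?_) (ae_of_all _ fun x => ?_)
        (ae_of_all _ fun x => ?_)
      · exact (((continuous_truncate n).comp hf).measurable.ennreal_ofReal).aemeasurable
      · intro a b hab
        simp only [htr]
        gcongr
      · refine tendsto_const_nhds.congr' ?_
        filter_upwards [eventually_ge_atTop ⌈f x⌉₊] with n hn
        rw [htr, min_eq_right (Nat.ceil_le.1 hn)]
    refine le_of_tendsto' hlim fun n => ?_
    rw [← ofReal_integral_eq_lintegral_ofReal (integrable_truncate hf n.cast_nonneg)
      (ae_of_all _ fun x => by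
        simp only [htr]; exact le_min n.cast_nonneg (hf0 x))]
    exact ENNReal.ofReal_le_ofReal (hle n)
  have hi : Integrable f (ρ : Measure ℝ) :=
    ⟨hf.aestronglyMeasurable, (hasFiniteIntegral_iff_ofReal (ae_of_all _ hf0)).2
      (hlint.trans_lt ENNReal.ofReal_lt_top)⟩
  refine ⟨hi, ?_⟩
  rw [← ofReal_integral_eq_lintegral_ofReal hi (ae_of_all _ hf0)] at hlint
  exact (ENNReal.ofReal_le_ofReal_iff hM0).1 hlint

/-- Weak limits of probability measures whose moments are eventually those of `μ` have the
moments of `μ`. -/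
lemma moments_eq_of_tendsto {ι : Type*} {F : Filter ι} [F.NeBot]
    {ν : ι → ProbabilityMeasure ℝ} {ρ : ProbabilityMeasure ℝ} (h : Tendsto ν F (𝓝 ρ))
    {μ : Measure ℝ} (hint : ∀ i (j : ℕ), Integrable (fun x => x ^ j) (ν i : Measure ℝ))
    (hmom : ∀ j : ℕ, ∀ᶠ i in F, ∫ x, x ^ j ∂(ν i : Measure ℝ) = ∫ x, x ^ j ∂μ) (j : ℕ) :
    Integrable (fun x => x ^ j) (ρ : Measure ℝ) ∧
      ∫ x, x ^ j ∂(ρ : Measure ℝ) = ∫ x, x ^ j ∂μ := by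
  have hsq : ∀ x : ℝ, (x ^ j) ^ 2 = x ^ (j * 2) := fun x => (pow_mul x j 2).symm
  have hc : Continuous fun x : ℝ => x ^ j := continuous_pow j
  set M := ∫ x, x ^ (j * 2) ∂μ
  obtain ⟨hρ2, hρM⟩ := integrable_and_integral_le_of_tendsto (M := M) h (f := fun x => (x ^ j) ^ 2)
    (by fun_prop) (fun x => sq_nonneg _) (fun i => by simpa only [hsq] using hint i (j * 2))
    (by
      filter_upwards [hmom (j * 2)] with i hi
      simp only [hsq, hi, M, le_refl])
  have hρ1 : Integrable (fun x => x ^ j) (ρ : Measure ℝ) := by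
    have : MemLp (fun x : ℝ => x ^ j) 2 (ρ : Measure ℝ) :=
      (memLp_two_iff_integrable_sq hc.aestronglyMeasurable).2 hρ2
    exact this.integrable one_le_two
  refine ⟨hρ1, ?_⟩
  have key : ∀ R : ℝ, 0 < R →
      |∫ x, x ^ j ∂(ρ : Measure ℝ) - ∫ x, x ^ j ∂μ| ≤ M / R + M / R := by
    intro R hR
    have h1 : |∫ x, x ^ j ∂(ρ : Measure ℝ) - ∫ x, truncate R (x ^ j) ∂(ρ : Measure ℝ)| ≤ M / R :=
      (abs_integral_sub_integral_truncate_le hc hρ1 hρ2 hR).trans (by gcongr)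
    have h2 : |∫ x, x ^ j ∂μ - ∫ x, truncate R (x ^ j) ∂(ρ : Measure ℝ)| ≤ M / R := by
      refine le_of_tendsto (((tendsto_integral_truncate h hc hR.le).const_sub _).abs) ?_
      filter_upwards [hmom j, hmom (j * 2)] with i hi hi2
      rw [← hi]
      have := abs_integral_sub_integral_truncate_le hc (hint i j)
        (by simpa only [hsq] using hint i (j * 2)) hR
      simpa only [hsq, hi2] using this
    rw [abs_sub_comm] at h2
    exact (abs_sub_le _ _ _).trans (add_le_add h1 h2)
  have hlim : Tendsto (fun R : ℝ => M / R + M / R) atTop (𝓝 0) := by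
    simpa using (tendsto_id.const_div_atTop M).add (tendsto_id.const_div_atTop M)
  have h0 := ge_of_tendsto hlim (eventually_gt_atTop 0 |>.mono key)
  exact sub_eq_zero.1 (abs_nonpos_iff.1 h0)

lemma isTightMeasureSet_of_integral_sq_le {S : Set (Measure ℝ)} {M : ℝ}
    (hS : ∀ ν ∈ S, IsFiniteMeasure ν ∧ Integrable (fun x => x ^ 2) ν ∧ ∫ x, x ^ 2 ∂ν ≤ M) :
    IsTightMeasureSet S := by
  rw [isTightMeasureSet_iff_exists_isCompact_measure_compl_le]
  intro ε hε
  have hlim : Tendsto (fun R : ℝ => ENNReal.ofReal (M / R ^ 2)) atTop (𝓝 0) := by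
    rw [← ENNReal.ofReal_zero]
    exact ENNReal.tendsto_ofReal ((tendsto_pow_atTop two_ne_zero).const_div_atTop M)
  obtain ⟨R, hR, hR0⟩ := ((hlim.eventually_lt_const hε).and (eventually_gt_atTop 0)).exists
  refine ⟨Metric.closedBall 0 R, isCompact_closedBall _ _, fun ν hν => ?_⟩
  obtain ⟨_, hi, hM⟩ := hS ν hν
  refine le_trans ?_ hR.le
  rw [← ofReal_measureReal]
  refine ENNReal.ofReal_le_ofReal ((le_div_iff₀' (by positivity)).2 ?_)
  have := mul_meas_ge_le_integral_of_nonneg (ae_of_all _ fun x => sq_nonneg x) hi (R ^ 2)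
  refine le_trans ?_ (this.trans hM)
  gcongr
  · exact measure_ne_top _ _
  · intro x hx
    simp only [Set.mem_compl_iff, Metric.mem_closedBall, dist_zero_right, Real.norm_eq_abs,
      not_le] at hx
    rw [Set.mem_ofPred_eq, ← sq_abs x]
    gcongr

/-- The method of moments for a moment-determinate limit. -/
theorem tendsto_of_moments_eventually_eq {ι : Type*} {F : Filter ι} (μ : ProbabilityMeasure ℝ)
    (hdet : ∀ ν : Measure ℝ, IsProbabilityMeasure ν →
      (∀ j : ℕ, Integrable (fun x => x ^ j) ν) →
      (∀ j : ℕ, ∫ x, x ^ j ∂ν = ∫ x, x ^ j ∂(μ : Measure ℝ)) → ν = μ)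
    (ν : ι → ProbabilityMeasure ℝ)
    (hint : ∀ i (j : ℕ), Integrable (fun x => x ^ j) (ν i : Measure ℝ))
    (hmom : ∀ j : ℕ, ∀ᶠ i in F, ∫ x, x ^ j ∂(ν i : Measure ℝ) = ∫ x, x ^ j ∂(μ : Measure ℝ)) :
    Tendsto ν F (𝓝 μ) := by
  rw [tendsto_iff_ultrafilter]
  intro g hg
  let S : Set (ProbabilityMeasure ℝ) :=
    ν '' {i | ∫ x, x ^ 2 ∂(ν i : Measure ℝ) = ∫ x, x ^ 2 ∂(μ : Measure ℝ)}
  have hS : IsCompact (closure S) := by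
    refine isCompact_closure_of_isTightMeasureSet
      (isTightMeasureSet_of_integral_sq_le (M := ∫ x, x ^ 2 ∂(μ : Measure ℝ)) ?_)
    rintro _ ⟨_, ⟨i, hi, rfl⟩, rfl⟩
    exact ⟨inferInstance, hint i 2, hi.le⟩
  have hmem : S ∈ g.map ν := by
    rw [Ultrafilter.mem_map]
    exact mem_of_superset (hg (hmom 2)) (Set.subset_preimage_image _ _)
  obtain ⟨ρ, -, hρ⟩ := hS.ultrafilter_le_nhds' (g.map ν) (mem_of_superset hmem subset_closure)
  have hρ' : Tendsto ν g (𝓝 ρ) := hρ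
  have hρm := moments_eq_of_tendsto hρ' hint fun j => hg (hmom j)
  have : ρ = μ := Subtype.ext
    (hdet ρ inferInstance (fun j => (hρm j).1) fun j => (hρm j).2)
  rwa [← this]

/-- The Stieltjes transform of a measure on the real line. -/
def stieltjesTransform (ν : Measure ℝ) (z : ℂ) : ℂ := ∫ x : ℝ, (z - (x : ℂ))⁻¹ ∂ν

lemma im_le_norm_sub_ofReal (z : ℂ) (x : ℝ) : z.im ≤ ‖z - x‖ := by
  simpa using (le_abs_self _).trans (Complex.abs_im_le_norm (z - x))

lemma sub_ofReal_ne_zero {z : ℂ} (hz : 0 < z.im) (x : ℝ) : z - x ≠ 0 :=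
  norm_pos_iff.1 (hz.trans_le (im_le_norm_sub_ofReal z x))

lemma continuous_inv_sub_ofReal {z : ℂ} (hz : 0 < z.im) :
    Continuous fun x : ℝ => (z - (x : ℂ))⁻¹ :=
  (continuous_const.sub Complex.continuous_ofReal).inv₀ (sub_ofReal_ne_zero hz)

lemma norm_inv_sub_ofReal_le {z : ℂ} (hz : 0 < z.im) (x : ℝ) : ‖(z - (x : ℂ))⁻¹‖ ≤ z.im⁻¹ := by
  rw [norm_inv]
  exact inv_anti₀ hz (im_le_norm_sub_ofReal z x)

lemma integrable_inv_sub_ofReal (ν : Measure ℝ) [IsFiniteMeasure ν] {z : ℂ} (hz : 0 < z.im) :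
    Integrable (fun x : ℝ => (z - (x : ℂ))⁻¹) ν :=
  Integrable.of_bound (continuous_inv_sub_ofReal hz).aestronglyMeasurable z.im⁻¹
    (ae_of_all _ (norm_inv_sub_ofReal_le hz))

lemma norm_stieltjesTransform_sub_le (ν : Measure ℝ) [IsProbabilityMeasure ν] {z w : ℂ}
    (hz : 0 < z.im) (hw : 0 < w.im) :
    ‖stieltjesTransform ν z - stieltjesTransform ν w‖ ≤ ‖w - z‖ * (z.im⁻¹ * w.im⁻¹) := by
  unfold stieltjesTransform
  rw [← integral_sub (integrable_inv_sub_ofReal ν hz) (integrable_inv_sub_ofReal ν hw)]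
  refine (norm_integral_le_of_norm_le_const (ae_of_all _ fun x => ?_)).trans_eq
    (by rw [probReal_univ, mul_one])
  have hzx := sub_ofReal_ne_zero hz x
  have hwx := sub_ofReal_ne_zero hw x
  have : (z - (x : ℂ))⁻¹ - (w - (x : ℂ))⁻¹ = (w - z) * ((z - (x : ℂ))⁻¹ * (w - (x : ℂ))⁻¹) := by
    field_simp
    ring
  rw [this, norm_mul, norm_mul]
  gcongr
  · exact norm_inv_sub_ofReal_le hz x
  · exact norm_inv_sub_ofReal_le hw x

lemma tendsto_stieltjesTransform {ι : Type*} {F : Filter ι} {ν : ι → ProbabilityMeasure ℝ}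
    {μ : ProbabilityMeasure ℝ} (h : Tendsto ν F (𝓝 μ)) {z : ℂ} (hz : 0 < z.im) :
    Tendsto (fun i => stieltjesTransform (ν i) z) F (𝓝 (stieltjesTransform μ z)) :=
  (ProbabilityMeasure.tendsto_iff_forall_integral_rclike_tendsto ℂ).1 h
    (BoundedContinuousFunction.ofNormedAddCommGroup (fun x : ℝ => (z - (x : ℂ))⁻¹)
      (continuous_inv_sub_ofReal hz) z.im⁻¹ (norm_inv_sub_ofReal_le hz))

/-- Weak convergence of probability measures implies locally uniform convergence of their
Stieltjes transforms in the upper half plane. -/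
theorem tendstoUniformlyOn_stieltjesTransform {ι : Type*} {F : Filter ι}
    {ν : ι → ProbabilityMeasure ℝ} {μ : ProbabilityMeasure ℝ} (h : Tendsto ν F (𝓝 μ))
    {K : Set ℂ} (hK : IsCompact K) (hK0 : K ⊆ {z : ℂ | 0 < z.im}) :
    TendstoUniformlyOn (fun i => stieltjesTransform (ν i)) (stieltjesTransform μ) F K := by
  rw [← tendstoLocallyUniformlyOn_iff_tendstoUniformlyOn_of_compact hK,
    Metric.tendstoLocallyUniformlyOn_iff]
  intro ε hε z hzK
  have hz : 0 < z.im := hK0 hzK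
  have hlim : Tendsto (fun w : ℂ => ‖w - z‖ * (z.im⁻¹ * w.im⁻¹)) (𝓝 z) (𝓝 0) := by
    have hc : ContinuousAt (fun w : ℂ => ‖w - z‖ * (z.im⁻¹ * w.im⁻¹)) z :=
      (by fun_prop : ContinuousAt (fun w : ℂ => ‖w - z‖) z).mul
        (continuousAt_const.mul (Complex.continuous_im.continuousAt.inv₀ hz.ne'))
    simpa [ContinuousAt] using hc
  have hε3 : 0 < ε / 3 := by positivity
  refine ⟨_, mem_nhdsWithin_of_mem_nhds ((hlim.eventually_lt_const hε3).and
    (Complex.continuous_im.continuousAt.eventually_const_lt hz)), ?_⟩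
  filter_upwards [Metric.tendsto_nhds.1 (tendsto_stieltjesTransform h hz) _ hε3] with i hi
  rintro w ⟨hw, hw0⟩
  have hμ := norm_stieltjesTransform_sub_le (μ : Measure ℝ) hz hw0
  have hν := norm_stieltjesTransform_sub_le (ν i : Measure ℝ) hz hw0
  rw [← dist_eq_norm] at hμ hν
  rw [dist_comm] at hi
  rw [dist_comm] at hμ
  have := dist_triangle4 (stieltjesTransform μ w) (stieltjesTransform μ z)
    (stieltjesTransform (ν i) z) (stieltjesTransform (ν i) w)
  linarith

/-- The `n × n` Jacobi matrix with diagonal `α 1, …, α n` and off-diagonal entries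
`√(β 1), …, √(β (n - 1))`. -/
def jacobiMatrix (α β : ℕ → ℝ) (n : ℕ) : Matrix (Fin n) (Fin n) ℝ := fun i j =>
  (if (j : ℕ) = i then α (i + 1) else 0) + (if (j : ℕ) = i + 1 then √(β j) else 0) +
    (if (i : ℕ) = j + 1 then √(β i) else 0)

lemma jacobiMatrix_isHermitian (α β : ℕ → ℝ) (n : ℕ) : (jacobiMatrix α β n).IsHermitian := by
  ext i j
  simp only [Matrix.conjTranspose_apply, star_trivial, jacobiMatrix]
  by_cases h : (i : ℕ) = j
  · simp [h]
  · simp [h, Ne.symm h]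
    ring

/-- Extension of a finite vector by zero. -/
def extendZero {n : ℕ} (u : Fin n → ℝ) (i : ℕ) : ℝ := if h : i < n then u ⟨i, h⟩ else 0

lemma sum_ite_val_eq_mul {n : ℕ} (u : Fin n → ℝ) (i : ℕ) (f : ℕ → ℝ) :
    ∑ j : Fin n, (if (j : ℕ) = i then f j else 0) * u j = f i * extendZero u i := by
  unfold extendZero
  split_ifs with h
  · rw [Finset.sum_eq_single ⟨i, h⟩]
    · simp
    · intro j _ hj
      rw [if_neg (fun h' => hj (Fin.ext h')), zero_mul]
    · simp
  · rw [mul_zero]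
    refine Finset.sum_eq_zero fun j _ => ?_
    rw [if_neg (by omega), zero_mul]

lemma jacobiMatrix_mulVec_zero (α β : ℕ → ℝ) {n : ℕ} (u : Fin n → ℝ) (h : 0 < n) :
    (jacobiMatrix α β n).mulVec u ⟨0, h⟩ =
      α 1 * extendZero u 0 + √(β 1) * extendZero u 1 := by
  have h1 := sum_ite_val_eq_mul u 0 fun _ => α 1
  have h2 := sum_ite_val_eq_mul u 1 fun j => √(β j)
  simp only [Matrix.mulVec, dotProduct]
  rw [← h1, ← h2, ← Finset.sum_add_distrib]
  refine Finset.sum_congr rfl fun j _ => ?_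
  simp [jacobiMatrix, add_mul]

lemma jacobiMatrix_mulVec_succ (α β : ℕ → ℝ) {n : ℕ} (u : Fin n → ℝ) {i : ℕ} (h : i + 1 < n) :
    (jacobiMatrix α β n).mulVec u ⟨i + 1, h⟩ =
      α (i + 2) * extendZero u (i + 1) + √(β (i + 2)) * extendZero u (i + 2) +
        √(β (i + 1)) * extendZero u i := by
  have h1 := sum_ite_val_eq_mul u (i + 1) fun _ => α (i + 2)
  have h2 := sum_ite_val_eq_mul u (i + 2) fun j => √(β j)
  have h3 := sum_ite_val_eq_mul u i fun _ => √(β (i + 1))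
  simp only [Matrix.mulVec, dotProduct]
  rw [← h1, ← h2, ← h3, ← Finset.sum_add_distrib, ← Finset.sum_add_distrib]
  refine Finset.sum_congr rfl fun j _ => ?_
  simp [jacobiMatrix, add_mul, eq_comm]

/-- Along an eigenvector of a Jacobi matrix, the components are given by the orthogonal
polynomials. -/
lemma eval_mul_eigenvector {P : ℕ → ℝ[X]} {α β : ℕ → ℝ}
    (hP0 : P 0 = 1) (hP1 : P 1 = X - C (α 1))
    (hrec : ∀ j, 1 ≤ j → P (j + 1) = (X - C (α (j + 1))) * P j - C (β j) * P (j - 1))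
    (hβ : ∀ j, 1 ≤ j → 0 ≤ β j) {n : ℕ} (u : Fin n → ℝ) {t : ℝ}
    (hu : (jacobiMatrix α β n).mulVec u = t • u) (j : ℕ) (hj : j ≤ n) :
    (P j).eval t * extendZero u 0 = (∏ i ∈ Finset.range j, √(β (i + 1))) * extendZero u j := by
  have hext : ∀ {i} (h : i < n), u ⟨i, h⟩ = extendZero u i := fun h => by simp [extendZero, h]
  induction j using Nat.strong_induction_on with
  | _ j ih =>
    match j with
    | 0 => simp [hP0]
    | 1 =>
      have h := congrFun hu ⟨0, hj⟩
      rw [jacobiMatrix_mulVec_zero, Pi.smul_apply, smul_eq_mul, hext] at h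
      simp only [hP1, eval_sub, eval_X, eval_C, Finset.prod_range_one, zero_add]
      linarith
    | j + 2 =>
      have h := congrFun hu ⟨j + 1, hj⟩
      rw [jacobiMatrix_mulVec_succ, Pi.smul_apply, smul_eq_mul, hext] at h
      have h1 := ih (j + 1) (by omega) (by omega)
      have h0 := ih j (by omega) (by omega)
      rw [Finset.prod_range_succ] at h1
      have hs := Real.mul_self_sqrt (hβ (j + 1) (by omega))
      simp only [hrec (j + 1) (by omega), Nat.add_sub_cancel, eval_sub, eval_mul, eval_X, eval_C,
        Finset.prod_range_succ]
      set p := ∏ i ∈ Finset.range j, √(β (i + 1))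
      linear_combination (t - α (j + 2)) * h1 - β (j + 1) * h0 - p * √(β (j + 1)) * h
        + p * extendZero u j * hs

/-- **Favard's theorem**, finite version: there is an `n`-point measure with respect to which
`P 1, …, P n` are orthogonal to the constants and which is supported on the zeros of `P n`. -/
theorem exists_quadrature {P : ℕ → ℝ[X]} {α β : ℕ → ℝ}
    (hP0 : P 0 = 1) (hP1 : P 1 = X - C (α 1))
    (hrec : ∀ j, 1 ≤ j → P (j + 1) = (X - C (α (j + 1))) * P j - C (β j) * P (j - 1))
    (hβ : ∀ j, 1 ≤ j → 0 ≤ β j) {n : ℕ} (hn : 0 < n) :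
    ∃ w t : Fin n → ℝ, (∀ k, 0 ≤ w k) ∧ ∑ k, w k = 1 ∧
      (∀ j, 1 ≤ j → j ≤ n → ∑ k, w k * (P j).eval (t k) = 0) ∧
      ∀ k, w k * (P n).eval (t k) = 0 := by
  have hJ := jacobiMatrix_isHermitian α β n
  set b := hJ.eigenvectorBasis with hb
  have hcol : ∀ i j : Fin n, ∑ k, b k i * b k j = if i = j then 1 else 0 := by
    intro i j
    have := b.sum_inner_mul_inner (EuclideanSpace.single i (1 : ℝ)) (EuclideanSpace.single j 1)
    simpa [EuclideanSpace.inner_single_left, EuclideanSpace.inner_single_right, eq_comm] using this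
  have hP := fun k => eval_mul_eigenvector hP0 hP1 hrec hβ (b k).ofLp
    (hJ.mulVec_eigenvectorBasis k)
  have hw : ∀ k, extendZero (b k).ofLp 0 = b k ⟨0, hn⟩ := fun k => by simp [extendZero, hn]
  have hn0 : ∀ k, extendZero (b k).ofLp n = 0 := fun k => by simp [extendZero]
  simp only [hw] at hP
  have hPn : ∀ k, b k ⟨0, hn⟩ ^ 2 * (P n).eval (hJ.eigenvalues k) = 0 := fun k => by
    have := hP k n le_rfl
    rw [hn0, mul_zero] at this
    linear_combination b k ⟨0, hn⟩ * this
  refine ⟨fun k => b k ⟨0, hn⟩ ^ 2, hJ.eigenvalues, fun k => sq_nonneg _, ?_, ?_, hPn⟩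
  · simpa [sq] using hcol ⟨0, hn⟩ ⟨0, hn⟩
  · intro j hj1 hj
    rcases hj.lt_or_eq with h | rfl
    · have hj' : ∀ k, extendZero (b k).ofLp j = b k ⟨j, h⟩ := fun k => by simp [extendZero, h]
      have h0 := hcol ⟨0, hn⟩ ⟨j, h⟩
      rw [if_neg (by simp; omega)] at h0
      calc ∑ k, b k ⟨0, hn⟩ ^ 2 * (P j).eval (hJ.eigenvalues k)
          = ∑ k, (∏ i ∈ Finset.range j, √(β (i + 1))) * (b k ⟨0, hn⟩ * b k ⟨j, h⟩) := by
            refine Finset.sum_congr rfl fun k _ => ?_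
            have := hP k j hj
            rw [hj'] at this
            linear_combination b k ⟨0, hn⟩ * this
        _ = 0 := by rw [← Finset.mul_sum, h0, mul_zero]
    · exact Finset.sum_eq_zero fun k _ => hPn k

/-- The finitely supported measure with weights `w` at the nodes `t`. -/
def atomicMeasure {n : ℕ} (w t : Fin n → ℝ) : Measure ℝ :=
  ∑ k, ENNReal.ofReal (w k) • Measure.dirac (t k)

lemma integrable_smul_dirac {E : Type*} [NormedAddCommGroup E] {f : ℝ → E} (a b : ℝ) :
    Integrable f (ENNReal.ofReal a • Measure.dirac b) :=
  (integrable_dirac (by simp)).smul_measure ENNReal.ofReal_ne_top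

lemma integrable_atomicMeasure {E : Type*} [NormedAddCommGroup E] {n : ℕ} (w t : Fin n → ℝ)
    (f : ℝ → E) : Integrable f (atomicMeasure w t) :=
  integrable_finsetSum_measure.2 fun _ _ => integrable_smul_dirac _ _

lemma integral_atomicMeasure {E : Type*} [NormedAddCommGroup E] [NormedSpace ℝ E]
    [CompleteSpace E] {n : ℕ} {w : Fin n → ℝ} (hw : ∀ k, 0 ≤ w k) (t : Fin n → ℝ) (f : ℝ → E) :
    ∫ x, f x ∂(atomicMeasure w t) = ∑ k, w k • f (t k) := by
  rw [atomicMeasure, integral_finsetSum_measure fun _ _ => integrable_smul_dirac _ _]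
  refine Finset.sum_congr rfl fun k _ => ?_
  rw [integral_smul_measure, integral_dirac, ENNReal.toReal_ofReal (hw k)]

lemma isProbabilityMeasure_atomicMeasure {n : ℕ} {w : Fin n → ℝ} (hw : ∀ k, 0 ≤ w k)
    (hw1 : ∑ k, w k = 1) (t : Fin n → ℝ) : IsProbabilityMeasure (atomicMeasure w t) := by
  constructor
  simp [atomicMeasure, ← ENNReal.ofReal_sum_of_nonneg fun k _ => hw k, hw1]

lemma integrable_eval {μ : Measure ℝ} (hmom : ∀ j : ℕ, Integrable (fun x => x ^ j) μ) (p : ℝ[X]) :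
    Integrable (fun x => p.eval x) μ := by
  simp only [eval_eq_sum_range]
  exact integrable_finsetSum _ fun i _ => (hmom i).const_mul _

lemma integral_eval_add_C_mul {μ : Measure ℝ} (hmom : ∀ j : ℕ, Integrable (fun x => x ^ j) μ)
    (p q : ℝ[X]) (a : ℝ) :
    ∫ x, (p + C a * q).eval x ∂μ = ∫ x, p.eval x ∂μ + a * ∫ x, q.eval x ∂μ := by
  simp only [eval_add, eval_mul, eval_C]
  rw [integral_add (integrable_eval hmom p) ((integrable_eval hmom q).const_mul a),
    integral_const_mul]

/-- Measures with the same integrals of `P 0, …, P n` have the same moments up to order `n`. -/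
lemma integral_pow_eq_of_integral_eval_eq {P : ℕ → ℝ[X]} {α β : ℕ → ℝ}
    (hP0 : P 0 = 1) (hP1 : P 1 = X - C (α 1))
    (hrec : ∀ j, 1 ≤ j → P (j + 1) = (X - C (α (j + 1))) * P j - C (β j) * P (j - 1))
    {μ ν : Measure ℝ} (hμ : ∀ j : ℕ, Integrable (fun x => x ^ j) μ)
    (hν : ∀ j : ℕ, Integrable (fun x => x ^ j) ν) {n : ℕ}
    (h : ∀ j ≤ n, ∫ x, (P j).eval x ∂ν = ∫ x, (P j).eval x ∂μ) {m : ℕ} (hm : m ≤ n) :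
    ∫ x, x ^ m ∂ν = ∫ x, x ^ m ∂μ := by
  have key : ∀ m j, m + j ≤ n →
      ∫ x, (X ^ m * P j).eval x ∂ν = ∫ x, (X ^ m * P j).eval x ∂μ := by
    intro m
    induction m with
    | zero => intro j hj; simpa using h j (by omega)
    | succ m ih =>
      intro j hj
      rcases Nat.eq_zero_or_pos j with rfl | hj0
      · have e : X ^ (m + 1) * P 0 = X ^ m * P 1 + C (α 1) * (X ^ m * P 0) := by
          rw [hP0, hP1]; ring
        rw [e, integral_eval_add_C_mul hν, integral_eval_add_C_mul hμ, ih 1 (by omega),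
          ih 0 (by omega)]
      · have e : X ^ (m + 1) * P j = X ^ m * P (j + 1) + C (α (j + 1)) * (X ^ m * P j)
            + C (β j) * (X ^ m * P (j - 1)) := by
          rw [hrec j hj0]; ring
        simp only [e, integral_eval_add_C_mul hν, integral_eval_add_C_mul hμ]
        rw [ih (j + 1) (by omega), ih j (by omega), ih (j - 1) (by omega)]
  simpa [hP0] using key m 0 (by omega)

section Convergents

variable {α β : ℕ → ℝ} {A B : ℕ → ℂ[X]}

/-- Polynomials satisfying a three term recurrence with real `α` and `β ≥ 0` have no zeros in the
upper half plane. -/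
lemma eval_ne_zero_of_recurrence (hB0 : B 0 = 1) (hB1 : B 1 = X - C ((α 1 : ℝ) : ℂ))
    (hB : ∀ j, B (j + 2) = (X - C ((α (j + 2) : ℝ) : ℂ)) * B (j + 1)
      - C ((β (j + 1) : ℝ) : ℂ) * B j)
    (hβ : ∀ j, 1 ≤ j → 0 ≤ β j) {z : ℂ} (hz : 0 < z.im) (j : ℕ) : (B j).eval z ≠ 0 := by
  suffices h : ∀ j, (B j).eval z ≠ 0 ∧ 0 < ((B (j + 1)).eval z / (B j).eval z).im from (h j).1
  intro j
  induction j with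
  | zero => simp [hB0, hB1, hz]
  | succ j ih =>
    obtain ⟨h0, h1⟩ := ih
    have hne : (B (j + 1)).eval z ≠ 0 := by
      intro h
      simp [h] at h1
    refine ⟨hne, ?_⟩
    have e : (B (j + 2)).eval z / (B (j + 1)).eval z = z - (α (j + 2) : ℝ)
        - (β (j + 1) : ℝ) * ((B (j + 1)).eval z / (B j).eval z)⁻¹ := by
      rw [hB]
      simp only [eval_sub, eval_mul, eval_X, eval_C]
      field_simp
    rw [e, Complex.sub_im, Complex.sub_im, Complex.ofReal_im, Complex.im_ofReal_mul,
      Complex.inv_im]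
    have : 0 ≤ β (j + 1) * (((B (j + 1)).eval z / (B j).eval z).im
        / Complex.normSq ((B (j + 1)).eval z / (B j).eval z)) :=
      mul_nonneg (hβ _ (by omega)) (div_nonneg h1.le (Complex.normSq_nonneg _))
    rw [neg_div, mul_neg]
    linarith

/-- The numerators of the convergents are the polynomials of the second kind of any finitely
supported measure orthogonal to `B 1, …, B n`. -/
lemma eval_eq_sum_of_recurrence (hA0 : A 0 = 0) (hB0 : B 0 = 1) (hA1 : A 1 = 1)
    (hB1 : B 1 = X - C ((α 1 : ℝ) : ℂ))
    (hA : ∀ j, A (j + 2) = (X - C ((α (j + 2) : ℝ) : ℂ)) * A (j + 1)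
      - C ((β (j + 1) : ℝ) : ℂ) * A j)
    (hB : ∀ j, B (j + 2) = (X - C ((α (j + 2) : ℝ) : ℂ)) * B (j + 1)
      - C ((β (j + 1) : ℝ) : ℂ) * B j)
    {ι : Type*} [Fintype ι] {w t : ι → ℂ} {n : ℕ} (hw : ∑ k, w k = 1)
    (hwB : ∀ j, 1 ≤ j → j ≤ n → ∑ k, w k * (B j).eval (t k) = 0)
    {z : ℂ} (hz : ∀ k, z - t k ≠ 0) (j : ℕ) (hj : j ≤ n) :
    (A j).eval z = ∑ k, w k * (((B j).eval z - (B j).eval (t k)) / (z - t k)) := by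
  induction j using Nat.strong_induction_on with
  | _ j ih =>
    match j with
    | 0 => simp [hA0, hB0]
    | 1 => simp [hA1, hB1, div_self (hz _), hw]
    | j + 2 =>
      have h1 := ih (j + 1) (by omega) (by omega)
      have h0 := ih j (by omega) (by omega)
      have hs := hwB (j + 1) (by omega) (by omega)
      have e : ∀ k, w k * (((B (j + 2)).eval z - (B (j + 2)).eval (t k)) / (z - t k)) =
          (z - (α (j + 2) : ℝ)) *
              (w k * (((B (j + 1)).eval z - (B (j + 1)).eval (t k)) / (z - t k)))
            - (β (j + 1) : ℝ) * (w k * (((B j).eval z - (B j).eval (t k)) / (z - t k)))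
            + w k * (B (j + 1)).eval (t k) := by
        intro k
        have := hz k
        rw [hB]
        simp only [eval_sub, eval_mul, eval_X, eval_C]
        field_simp
        ring
      rw [Finset.sum_congr rfl fun k _ => e k, Finset.sum_add_distrib, hs, add_zero,
        Finset.sum_sub_distrib, ← Finset.mul_sum, ← Finset.mul_sum, ← h1, ← h0, hA]
      simp only [eval_sub, eval_mul, eval_X, eval_C]

end Convergents

lemma eq_map_ofReal_of_recurrence {P : ℕ → ℝ[X]} {α β : ℕ → ℝ} {B : ℕ → ℂ[X]}
    (hP0 : P 0 = 1) (hP1 : P 1 = X - C (α 1))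
    (hrec : ∀ j, 1 ≤ j → P (j + 1) = (X - C (α (j + 1))) * P j - C (β j) * P (j - 1))
    (hB0 : B 0 = 1) (hB1 : B 1 = X - C ((α 1 : ℝ) : ℂ))
    (hB : ∀ j, B (j + 2) = (X - C ((α (j + 2) : ℝ) : ℂ)) * B (j + 1)
      - C ((β (j + 1) : ℝ) : ℂ) * B j) (j : ℕ) :
    B j = (P j).map Complex.ofRealHom := by
  induction j using Nat.strong_induction_on with
  | _ j ih =>
    match j with
    | 0 => simp [hB0, hP0]
    | 1 => simp [hB1, hP1]
    | j + 2 =>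
      rw [hB, ih (j + 1) (by omega), ih j (by omega), hrec (j + 1) (by omega)]
      simp

/-- The `n`-th convergent is the Stieltjes transform of a probability measure having the same
moments as `μ` up to order `n`. -/
theorem exists_probabilityMeasure_convergent (μ : Measure ℝ) [IsProbabilityMeasure μ]
    (hmom : ∀ j : ℕ, Integrable (fun x => x ^ j) μ)
    {P : ℕ → ℝ[X]} {α β : ℕ → ℝ} {A B : ℕ → ℂ[X]}
    (hP0 : P 0 = 1) (hP1 : P 1 = X - C (α 1))
    (hrec : ∀ j, 1 ≤ j → P (j + 1) = (X - C (α (j + 1))) * P j - C (β j) * P (j - 1))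
    (hPμ : ∀ j, 1 ≤ j → ∫ x, (P j).eval x ∂μ = 0)
    (hβ : ∀ j, 1 ≤ j → 0 ≤ β j)
    (hA0 : A 0 = 0) (hB0 : B 0 = 1) (hA1 : A 1 = 1) (hB1 : B 1 = X - C ((α 1 : ℝ) : ℂ))
    (hA : ∀ j, A (j + 2) = (X - C ((α (j + 2) : ℝ) : ℂ)) * A (j + 1)
      - C ((β (j + 1) : ℝ) : ℂ) * A j)
    (hB : ∀ j, B (j + 2) = (X - C ((α (j + 2) : ℝ) : ℂ)) * B (j + 1)
      - C ((β (j + 1) : ℝ) : ℂ) * B j) {n : ℕ} (hn : 0 < n) :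
    ∃ ν : ProbabilityMeasure ℝ, (∀ j : ℕ, Integrable (fun x => x ^ j) (ν : Measure ℝ)) ∧
      (∀ m ≤ n, ∫ x, x ^ m ∂(ν : Measure ℝ) = ∫ x, x ^ m ∂μ) ∧
      ∀ z : ℂ, 0 < z.im → stieltjesTransform ν z = (A n).eval z / (B n).eval z := by
  obtain ⟨w, t, hw, hw1, hwP, hwn⟩ := exists_quadrature hP0 hP1 hrec hβ hn
  have hν := isProbabilityMeasure_atomicMeasure hw hw1 t
  have hint : ∀ j : ℕ, Integrable (fun x => x ^ j) (atomicMeasure w t) :=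
    fun j => integrable_atomicMeasure w t _
  refine ⟨⟨atomicMeasure w t, hν⟩, hint, fun m hm => ?_, fun z hz => ?_⟩
  · refine integral_pow_eq_of_integral_eval_eq hP0 hP1 hrec hmom hint (fun j hj => ?_) hm
    rcases Nat.eq_zero_or_pos j with rfl | hj0
    · simp [hP0]
    · rw [hPμ j hj0, integral_atomicMeasure hw]
      exact hwP j hj0 hj
  · have hBP : ∀ j (x : ℝ), (B j).eval (x : ℂ) = ((P j).eval x : ℝ) := fun j x => by
      rw [eq_map_ofReal_of_recurrence hP0 hP1 hrec hB0 hB1 hB j]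
      exact eval_map_apply (f := Complex.ofRealHom) x
    have hwB : ∀ j, 1 ≤ j → j ≤ n → ∑ k, (w k : ℂ) * (B j).eval (t k : ℂ) = 0 := by
      intro j h1 hj
      simp only [hBP]
      exact_mod_cast hwP j h1 hj
    have hne := eval_ne_zero_of_recurrence hB0 hB1 hB hβ hz n
    rw [eq_div_iff hne, eval_eq_sum_of_recurrence hA0 hB0 hA1 hB1 hA hB
      (w := fun k => (w k : ℂ)) (t := fun k => (t k : ℂ)) (by exact_mod_cast hw1) hwB
      (fun k => sub_ofReal_ne_zero hz (t k)) n le_rfl]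
    change (∫ x : ℝ, (z - (x : ℂ))⁻¹ ∂(atomicMeasure w t)) * _ = _
    rw [integral_atomicMeasure hw, Finset.sum_mul]
    refine Finset.sum_congr rfl fun k _ => ?_
    have h0 : (w k : ℂ) * (B n).eval (t k : ℂ) = 0 := by
      rw [hBP]
      exact_mod_cast hwn k
    rw [← mul_div_assoc, mul_sub, h0, Complex.real_smul]
    ring

/-- For a moment-determinate measure `μ` with recurrence coefficients
`α_j, β_j` of its monic orthogonal polynomials (with the convention `β_j = 0`,
`α_{j+1} = 0` for `j ≥ N` if `μ` is supported on exactly `N` points, which is encoded by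
the junk-value conventions of real division below), the convergents `A_l/B_l` of the
continued fraction expansion converge to the Stieltjes transform
`Φ(z) = ∫ (z-x)⁻¹ dμ(x)`, uniformly on compact subsets of the upper half plane. -/
theorem statement9 (μ : Measure ℝ) [IsProbabilityMeasure μ]
    (hmom : ∀ j : ℕ, Integrable (fun x => x ^ j) μ)
    (hdet : ∀ ν : Measure ℝ, IsProbabilityMeasure ν →
      (∀ j : ℕ, Integrable (fun x => x ^ j) ν) →
      (∀ j : ℕ, ∫ x, x ^ j ∂ν = ∫ x, x ^ j ∂μ) → ν = μ)
    (P : ℕ → Polynomial ℝ) (α β : ℕ → ℝ)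
    (hP0 : P 0 = 1) (hP1 : P 1 = X - C (α 1))
    (hrec : ∀ j, 1 ≤ j → P (j + 1) = (X - C (α (j + 1))) * P j - C (β j) * P (j - 1))
    (horth : ∀ i j : ℕ, i ≠ j → ∫ x, (P i).eval x * (P j).eval x ∂μ = 0)
    (hβ0 : ∀ j, 1 ≤ j → 0 ≤ β j)
    (hα : ∀ j : ℕ, α (j + 1) =
      (∫ x, x * ((P j).eval x) ^ 2 ∂μ) / ∫ x, ((P j).eval x) ^ 2 ∂μ)
    (hβ : ∀ j, 1 ≤ j →
      β j = (∫ x, ((P j).eval x) ^ 2 ∂μ) / ∫ x, ((P (j - 1)).eval x) ^ 2 ∂μ)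
    (A B : ℕ → Polynomial ℂ)
    (hA0 : A 0 = 0) (hB0 : B 0 = 1) (hA1 : A 1 = 1)
    (hB1 : B 1 = X - C ((α 1 : ℝ) : ℂ))
    (hABrec : ∀ j, 2 ≤ j →
      A j = (X - C ((α j : ℝ) : ℂ)) * A (j - 1) - C ((β (j - 1) : ℝ) : ℂ) * A (j - 2) ∧
      B j = (X - C ((α j : ℝ) : ℂ)) * B (j - 1) - C ((β (j - 1) : ℝ) : ℂ) * B (j - 2)) :
    ∀ K : Set ℂ, IsCompact K → K ⊆ {z : ℂ | 0 < z.im} →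
      TendstoUniformlyOn (fun l z => (A l).eval z / (B l).eval z)
        (fun z => ∫ x, (z - (x : ℂ))⁻¹ ∂μ) atTop K := by
  have hA : ∀ j, A (j + 2) = (X - C ((α (j + 2) : ℝ) : ℂ)) * A (j + 1)
      - C ((β (j + 1) : ℝ) : ℂ) * A j := fun j => (hABrec (j + 2) (by omega)).1
  have hB : ∀ j, B (j + 2) = (X - C ((α (j + 2) : ℝ) : ℂ)) * B (j + 1)
      - C ((β (j + 1) : ℝ) : ℂ) * B j := fun j => (hABrec (j + 2) (by omega)).2
  have hPμ : ∀ j, 1 ≤ j → ∫ x, (P j).eval x ∂μ = 0 := fun j hj => by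
    simpa [hP0] using horth 0 j (by omega)
  have hex : ∀ n : ℕ, ∃ ν : ProbabilityMeasure ℝ,
      (∀ j : ℕ, Integrable (fun x => x ^ j) (ν : Measure ℝ)) ∧
      (∀ m ≤ n, ∫ x, x ^ m ∂(ν : Measure ℝ) = ∫ x, x ^ m ∂μ) ∧
      (0 < n → ∀ z : ℂ, 0 < z.im →
        stieltjesTransform ν z = (A n).eval z / (B n).eval z) := by
    intro n
    rcases Nat.eq_zero_or_pos n with rfl | hn
    · exact ⟨⟨μ, inferInstance⟩, hmom, fun _ _ => rfl, fun h => absurd h (lt_irrefl 0)⟩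
    · obtain ⟨ν, h1, h2, h3⟩ := exists_probabilityMeasure_convergent μ hmom hP0 hP1 hrec hPμ hβ0
        hA0 hB0 hA1 hB1 hA hB hn
      exact ⟨ν, h1, h2, fun _ => h3⟩
  choose ν hint hνmom hνS using hex
  have hlim : Tendsto ν atTop (𝓝 ⟨μ, inferInstance⟩) :=
    tendsto_of_moments_eventually_eq ⟨μ, inferInstance⟩ hdet ν hint fun j =>
      (eventually_ge_atTop j).mono fun n hn => hνmom n j hn
  intro K hK hK0
  refine (tendstoUniformlyOn_stieltjesTransform hlim hK hK0).congr ?_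
  filter_upwards [eventually_gt_atTop 0] with n hn z hz
  exact hνS n hn z (hK0 hz)

end
end

section
/- Let α ∈ ℝ, β > 0, and let μ_{SC,α,β} be the semicircle measure with density x ↦ (1/(2πβ)) √(4β−(x−α)²) on [α−2√β, α+2√β]. Then for every z ∈ ℂ with Im z > 0, the Stieltjes transform Φ(z) = ∫ 1/(z−x) dμ_{SC,α,β}(x) satisfies the quadratic equation β·Φ(z)² − (z−α)·Φ(z) + 1 = 0 and Im Φ(z) < 0; equivalently, Φ(z) = (z−α−√((z−α)²−4β))/(2β), where √((z−α)²−4β) denotes the unique square root with positive imaginary part (which exists since (z−α)²−4β ∉ [0,∞) for Im z > 0). -/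
open MeasureTheory Real Filter Topology Polynomial

noncomputable section
/-- Density of the semicircle measure `μ_{SC,α,β}`. -/
def scDensity (al be : ℝ) (x : ℝ) : ℝ :=
  if x ∈ Set.Icc (al - 2 * Real.sqrt be) (al + 2 * Real.sqrt be) then
    Real.sqrt (4 * be - (x - al) ^ 2) / (2 * π * be)
  else 0

/-- The semicircle measure `μ_{SC,α,β}`. -/
def muSC (al be : ℝ) : Measure ℝ :=
  volume.withDensity (fun x => ENNReal.ofReal (scDensity al be x))

/-- Generating function of `sin θ * sin ((n + 1) θ)`. -/
theorem hasSum_pow_mul_sin_mul_sin {q : ℂ} (hq : ‖q‖ < 1) (θ : ℝ) :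
    HasSum (fun n : ℕ => q ^ n * ((Real.sin θ * Real.sin ((n + 1) * θ) : ℝ) : ℂ))
      ((Real.sin θ : ℂ) ^ 2 / (1 - 2 * q * Real.cos θ + q ^ 2)) := by
  set E := Complex.exp (θ * Complex.I) with hE
  set F := Complex.exp (-θ * Complex.I) with hF
  have hEF : E * F = 1 := by
    rw [hE, hF, ← Complex.exp_add]
    simp
  have hnE : ‖E‖ = 1 := Complex.norm_exp_ofReal_mul_I θ
  have hnF : ‖F‖ = 1 := by
    rw [hF, ← Complex.ofReal_neg]
    exact Complex.norm_exp_ofReal_mul_I (-θ)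
  have hqE : ‖q * E‖ < 1 := by rwa [norm_mul, hnE, mul_one]
  have hqF : ‖q * F‖ < 1 := by rwa [norm_mul, hnF, mul_one]
  have hne : ∀ w : ℂ, ‖w‖ < 1 → 1 - w ≠ 0 := fun w hw h => by
    rw [← sub_eq_zero.mp h, norm_one] at hw
    exact lt_irrefl _ hw
  have hsin : (Real.sin θ : ℂ) = (F - E) * Complex.I / 2 := by
    rw [Complex.ofReal_sin, Complex.sin]
  have hcos : (Real.cos θ : ℂ) = (E + F) / 2 := by
    rw [Complex.ofReal_cos, Complex.cos]
  have hsum := (((hasSum_geometric_of_norm_lt_one hqF).mul_left F).sub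
    ((hasSum_geometric_of_norm_lt_one hqE).mul_left E)).mul_left
      ((Real.sin θ : ℂ) * (Complex.I / 2))
  have hden : 1 - 2 * q * Real.cos θ + q ^ 2 = (1 - q * E) * (1 - q * F) := by
    rw [hcos]
    linear_combination -q ^ 2 * hEF
  have hval : (Real.sin θ : ℂ) ^ 2 / (1 - 2 * q * Real.cos θ + q ^ 2) =
      (Real.sin θ : ℂ) * (Complex.I / 2) * (F * (1 - q * F)⁻¹ - E * (1 - q * E)⁻¹) := by
    have h1 := hne _ hqE
    have h2 := hne _ hqF
    rw [hden, sq, ← div_eq_mul_inv, ← div_eq_mul_inv, div_sub_div _ _ h2 h1]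
    nth_rewrite 2 [hsin]
    ring
  rw [hval]
  refine hsum.congr_fun fun n => ?_
  have hsinn : ((Real.sin ((n + 1) * θ) : ℝ) : ℂ) =
      (F ^ (n + 1) - E ^ (n + 1)) * Complex.I / 2 := by
    rw [Complex.ofReal_sin, Complex.sin, hE, hF, ← Complex.exp_nat_mul, ← Complex.exp_nat_mul]
    push_cast
    ring_nf
  rw [Complex.ofReal_mul, hsinn]
  ring

theorem integral_sin_mul_sin_succ (n : ℕ) :
    ∫ θ in (0 : ℝ)..π, Real.sin θ * Real.sin ((n + 1) * θ) = if n = 0 then π / 2 else 0 := by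
  split_ifs with hn
  · subst hn
    simp [← sq]
  · have hcos : ∀ k : ℕ, k ≠ 0 → ∫ θ in (0 : ℝ)..π, Real.cos (k * θ) = 0 := fun k hk => by
      rw [intervalIntegral.integral_comp_mul_left (fun x => Real.cos x) (Nat.cast_ne_zero.mpr hk)]
      simp
    have heq : ∀ θ : ℝ, Real.sin θ * Real.sin ((n + 1) * θ) =
        (1 / 2) * (Real.cos (n * θ) - Real.cos ((n + 2 : ℕ) * θ)) := fun θ => by
      have h1 : (n : ℝ) * θ = (n + 1) * θ - θ := by ring
      have h2 : ((n + 2 : ℕ) : ℝ) * θ = (n + 1) * θ + θ := by push_cast; ring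
      rw [h1, h2, Real.cos_sub, Real.cos_add]
      ring
    simp_rw [heq]
    rw [intervalIntegral.integral_const_mul, intervalIntegral.integral_sub
      (Continuous.intervalIntegrable (by fun_prop) _ _)
      (Continuous.intervalIntegrable (by fun_prop) _ _), hcos n hn, hcos _ (by simp)]
    simp

theorem integral_sin_sq_div {q : ℂ} (hq : ‖q‖ < 1) :
    ∫ θ in (0 : ℝ)..π, (Real.sin θ : ℂ) ^ 2 / (1 - 2 * q * Real.cos θ + q ^ 2) =
      (π : ℂ) / 2 := by
  have h := intervalIntegral.hasSum_integral_of_dominated_convergence (a := 0) (b := π)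
    (μ := volume) (F := fun (n : ℕ) (θ : ℝ) =>
      q ^ n * ((Real.sin θ * Real.sin ((n + 1) * θ) : ℝ) : ℂ))
    (f := fun θ : ℝ => (Real.sin θ : ℂ) ^ 2 / (1 - 2 * q * Real.cos θ + q ^ 2))
    (fun n _ => ‖q‖ ^ n)
    (fun n => Continuous.aestronglyMeasurable (by fun_prop))
    (fun n => Eventually.of_forall fun θ _ => by
      rw [norm_mul, norm_pow, Complex.norm_real, norm_mul]
      refine mul_le_of_le_one_right (by positivity) (mul_le_one₀ ?_ (norm_nonneg _) ?_)
      · exact Real.abs_sin_le_one _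
      · exact Real.abs_sin_le_one _)
    (Eventually.of_forall fun θ _ => summable_geometric_of_lt_one (norm_nonneg _) hq)
    (by simp)
    (Eventually.of_forall fun θ _ => hasSum_pow_mul_sin_mul_sin hq θ)
  have hterm : ∀ n : ℕ, ∫ θ in (0 : ℝ)..π,
      q ^ n * ((Real.sin θ * Real.sin ((n + 1) * θ) : ℝ) : ℂ) =
        if n = 0 then (π : ℂ) / 2 else 0 := fun n => by
    rw [intervalIntegral.integral_const_mul, intervalIntegral.integral_ofReal,
      integral_sin_mul_sin_succ]
    split_ifs with hn <;> simp [hn]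
  simp_rw [hterm] at h
  exact h.unique (hasSum_ite_eq 0 _)

/-- The Joukowski parametrization of the upper half plane by the lower half of the unit disc. -/
theorem exists_norm_lt_one_joukowski {u : ℂ} (hu : 0 < u.im) :
    ∃ q : ℂ, q ≠ 0 ∧ ‖q‖ < 1 ∧ q.im < 0 ∧ u = q + q⁻¹ := by
  have him : ∀ q : ℂ, (q + q⁻¹).im = q.im * (1 - (Complex.normSq q)⁻¹) := fun q => by
    rw [Complex.add_im, Complex.inv_im, neg_div, div_eq_mul_inv]
    ring
  have hroot : ∃ q : ℂ, q ≠ 0 ∧ u = q + q⁻¹ := by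
    obtain ⟨w, hw⟩ := IsAlgClosed.exists_pow_nat_eq (u ^ 2 - 4) (n := 2) (by norm_num)
    have hmul : (u + w) / 2 * ((u - w) / 2) = 1 := by linear_combination -hw / 4
    refine ⟨(u + w) / 2, left_ne_zero_of_mul_eq_one hmul, ?_⟩
    rw [inv_eq_of_mul_eq_one_right hmul]
    ring
  have hlt : ∃ q : ℂ, q ≠ 0 ∧ ‖q‖ < 1 ∧ u = q + q⁻¹ := by
    obtain ⟨q, hq0, hq⟩ := hroot
    rcases lt_trichotomy ‖q‖ 1 with h | h | h
    · exact ⟨q, hq0, h, hq⟩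
    · rw [hq, him, Complex.normSq_eq_norm_sq, h] at hu
      simp at hu
    · exact ⟨q⁻¹, inv_ne_zero hq0, by rw [norm_inv]; exact inv_lt_one_of_one_lt₀ h,
        by rw [inv_inv, hq, add_comm]⟩
  obtain ⟨q, hq0, hq1, hq⟩ := hlt
  refine ⟨q, hq0, hq1, ?_, hq⟩
  rw [hq, him] at hu
  have hpos : 0 < Complex.normSq q := Complex.normSq_pos.mpr hq0
  have hlt1 : Complex.normSq q < 1 := by
    rw [Complex.normSq_eq_norm_sq]
    exact pow_lt_one₀ (norm_nonneg _) hq1 two_ne_zero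
  have := (one_lt_inv₀ hpos).mpr hlt1
  by_contra! h
  exact absurd hu (not_lt.mpr (mul_nonpos_of_nonneg_of_nonpos h (by linarith)))

theorem integral_muSC (al be : ℝ) (hbe : 0 < be) (f : ℝ → ℂ) :
    ∫ x, f x ∂(muSC al be) = ∫ x in (al - 2 * √be)..(al + 2 * √be),
      ((√(4 * be - (x - al) ^ 2) / (2 * π * be) : ℝ) : ℂ) * f x := by
  have hmeas : Measurable (scDensity al be) := by
    unfold scDensity
    exact Measurable.ite measurableSet_Icc (by fun_prop) measurable_const
  have hnonneg : ∀ x, 0 ≤ scDensity al be x := fun x => by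
    unfold scDensity
    split_ifs <;> positivity
  have hle : al - 2 * √be ≤ al + 2 * √be := by linarith [Real.sqrt_nonneg be]
  rw [muSC, integral_withDensity_eq_integral_toReal_smul (by fun_prop) (by simp),
    intervalIntegral.integral_of_le hle, ← integral_Icc_eq_integral_Ioc,
    ← integral_indicator measurableSet_Icc]
  congr 1
  funext x
  rw [ENNReal.toReal_ofReal (hnonneg x), Complex.real_smul]
  by_cases hx : x ∈ Set.Icc (al - 2 * √be) (al + 2 * √be) <;> simp [scDensity, hx]

theorem integral_muSC_eq_integral_sin_sq (al be : ℝ) (hbe : 0 < be) {f : ℝ → ℂ}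
    (hf : Continuous f) :
    ∫ x, f x ∂(muSC al be) =
      2 / π * ∫ θ in (0 : ℝ)..π, (Real.sin θ : ℂ) ^ 2 * f (al - 2 * √be * Real.cos θ) := by
  have hs : 0 < √be := Real.sqrt_pos.mpr hbe
  have hsq : √be ^ 2 = be := Real.sq_sqrt hbe.le
  have hsub := intervalIntegral.integral_deriv_smul_comp (a := 0) (b := π)
    (f := fun θ => al - 2 * √be * Real.cos θ) (f' := fun θ => 2 * √be * Real.sin θ)
    (g := fun x => ((√(4 * be - (x - al) ^ 2) / (2 * π * be) : ℝ) : ℂ) * f x)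
    (fun θ _ => by
      simpa using ((Real.hasDerivAt_cos θ).const_mul (2 * √be)).const_sub al)
    (by fun_prop) (by fun_prop)
  rw [integral_muSC al be hbe]
  simp only [Real.cos_zero, Real.cos_pi, mul_one, mul_neg, sub_neg_eq_add] at hsub
  rw [← hsub, ← intervalIntegral.integral_const_mul]
  refine intervalIntegral.integral_congr fun θ hθ => ?_
  rw [Set.uIcc_of_le Real.pi_pos.le] at hθ
  have hsin := Real.sin_nonneg_of_mem_Icc hθ
  have hroot : √(4 * be - (al - 2 * √be * Real.cos θ - al) ^ 2) = 2 * √be * Real.sin θ := by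
    rw [← Real.sqrt_sq (show 0 ≤ 2 * √be * Real.sin θ by positivity)]
    congr 1
    linear_combination (-4 * Real.cos θ ^ 2 - 4 * Real.sin θ ^ 2) * hsq
      - 4 * be * Real.sin_sq_add_cos_sq θ
  have hcoef : 2 * √be * Real.sin θ * (2 * √be * Real.sin θ / (2 * π * be)) =
      2 / π * Real.sin θ ^ 2 := by
    have := Real.pi_ne_zero
    field_simp
    linear_combination Real.sin θ ^ 2 * hsq
  simp only [Function.comp_apply]
  rw [hroot, Complex.real_smul, ← mul_assoc, ← Complex.ofReal_mul, hcoef]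
  push_cast
  ring

/-- The Stieltjes transform of the semicircle measure in Joukowski coordinates. -/
theorem integral_inv_sub_muSC (al be : ℝ) (hbe : 0 < be) {z q : ℂ} (hz : 0 < z.im)
    (hq0 : q ≠ 0) (hq1 : ‖q‖ < 1) (hq : z - al = √be * (q + q⁻¹)) :
    ∫ x, (z - (x : ℂ))⁻¹ ∂(muSC al be) = q / √be := by
  have hs : (√be : ℂ) ≠ 0 := Complex.ofReal_ne_zero.mpr (Real.sqrt_pos.mpr hbe).ne'
  have hcont : Continuous fun x : ℝ => (z - (x : ℂ))⁻¹ := by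
    refine Continuous.inv₀ (by fun_prop) fun x h => ?_
    have := congrArg Complex.im h
    simp [hz.ne'] at this
  have hnorm : ‖-q‖ < 1 := by rwa [norm_neg]
  have heq : ∀ θ : ℝ,
      (Real.sin θ : ℂ) ^ 2 * (z - ((al - 2 * √be * Real.cos θ : ℝ) : ℂ))⁻¹ =
        q / √be * ((Real.sin θ : ℂ) ^ 2 / (1 - 2 * (-q) * Real.cos θ + (-q) ^ 2)) := fun θ => by
    have hden : z - ((al - 2 * √be * Real.cos θ : ℝ) : ℂ) =
        √be / q * (1 - 2 * (-q) * Real.cos θ + (-q) ^ 2) := by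
      push_cast
      field_simp at hq ⊢
      linear_combination hq
    rw [hden, mul_inv, inv_div]
    ring
  rw [integral_muSC_eq_integral_sin_sq al be hbe hcont]
  simp_rw [heq]
  rw [intervalIntegral.integral_const_mul, integral_sin_sq_div hnorm]
  have : (π : ℂ) ≠ 0 := Complex.ofReal_ne_zero.mpr Real.pi_ne_zero
  field_simp

/-- The Stieltjes transform of the semicircle measure satisfies
`β Φ(z)² - (z-α) Φ(z) + 1 = 0` and `Im Φ(z) < 0` on the upper half plane; equivalently
`Φ(z) = (z - α - √((z-α)² - 4β))/(2β)` with the square root of positive imaginary part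
(which exists). -/
theorem statement11 (al be : ℝ) (hbe : 0 < be) (z : ℂ) (hz : 0 < z.im)
    (Φ : ℂ) (hΦ : Φ = ∫ x, (z - (x : ℂ))⁻¹ ∂(muSC al be)) :
    (be : ℂ) * Φ ^ 2 - (z - (al : ℂ)) * Φ + 1 = 0 ∧ Φ.im < 0 ∧
      (∃ w : ℂ, w ^ 2 = (z - (al : ℂ)) ^ 2 - 4 * (be : ℂ) ∧ 0 < w.im) ∧
      (∀ w : ℂ, w ^ 2 = (z - (al : ℂ)) ^ 2 - 4 * (be : ℂ) → 0 < w.im →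
        Φ = (z - (al : ℂ) - w) / (2 * (be : ℂ))) := by
  have hs : 0 < √be := Real.sqrt_pos.mpr hbe
  have hsC : (√be : ℂ) ≠ 0 := Complex.ofReal_ne_zero.mpr hs.ne'
  have hsq : (√be : ℂ) ^ 2 = be := by rw [← Complex.ofReal_pow, Real.sq_sqrt hbe.le]
  have hbeC : (be : ℂ) ≠ 0 := Complex.ofReal_ne_zero.mpr hbe.ne'
  obtain ⟨q, hq0, hq1, hqim, hq⟩ := exists_norm_lt_one_joukowski
    (u := (z - al) / √be) (by rw [Complex.div_ofReal_im]; simpa using div_pos hz hs)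
  have hzq : z - al = √be * (q + q⁻¹) := by rw [← hq]; field_simp
  rw [integral_inv_sub_muSC al be hbe hz hq0 hq1 hzq] at hΦ
  have hquad : (be : ℂ) * Φ ^ 2 - (z - (al : ℂ)) * Φ + 1 = 0 := by
    rw [hΦ, hzq, ← hsq]
    field_simp
    ring
  have him : Φ.im < 0 := by
    rw [hΦ, Complex.div_ofReal_im]
    exact div_neg_of_neg_of_pos hqim hs
  have hroot : (z - al - 2 * be * Φ) ^ 2 = (z - (al : ℂ)) ^ 2 - 4 * (be : ℂ) := by
    linear_combination 4 * (be : ℂ) * hquad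
  have hrootim : 0 < (z - al - 2 * be * Φ).im := by
    have : (z - al - 2 * be * Φ).im = z.im - 2 * be * Φ.im := by simp
    rw [this]
    nlinarith
  refine ⟨hquad, him, ⟨_, hroot, hrootim⟩, fun w hw hwim => ?_⟩
  rcases sq_eq_sq_iff_eq_or_eq_neg.mp (hw.trans hroot.symm) with h | h
  · rw [h]
    field_simp
    ring
  · rw [h, Complex.neg_im] at hwim
    linarith

end
end
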